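/- arXiv:2410.14199 — 2 statements merged into one kernel-verified Lean document; each statement's English description precedes it below -/
import Mathlib

section
/- For n ≥ 2, the derangement inversion sequences D_n (n-inversion sequences e with e_n ≠ 0 and no index i with e_i = e_{i+1} = 0) are equinumerous with the derangements of {1,...,n}; moreover Σ_{e ∈ D_n} t^{asc(e)} = Σ_{σ derangement of [n]} t^{exc(σ)}, where exc(σ) = #{ i : σ(i) > i }. -/
/-- Number of ascents of a length-`n` sequence (0-indexed positions `0,...,n-2`). -/
def ascN (n : ℕ) (f : ℕ → ℕ) : ℕ :=
  ((Finset.range (n - 1)).filter (fun i => f i < f (i + 1))).card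

/-- The Finset of `n`-inversion sequences, as functions `Fin n → ℕ` with `e i ≤ i`. -/
def invSeqs (n : ℕ) : Finset (Fin n → ℕ) :=
  Fintype.piFinset (fun i => Finset.range (i.1 + 1))

/-- Extension of `e : Fin n → ℕ` to `ℕ → ℕ` by zero. -/
def ext {n : ℕ} (e : Fin n → ℕ) : ℕ → ℕ := fun i =>
  if h : i < n then e ⟨i, h⟩ else 0

/-- The Finset `D_n` of derangement inversion sequences: `n`-inversion sequences whose
last entry is nonzero and having no two consecutive zero entries. -/
def derangeSeqs (n : ℕ) : Finset (Fin n → ℕ) :=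
  (invSeqs n).filter
    (fun e => ext e (n - 1) ≠ 0 ∧ ∀ i < n - 1, ¬(ext e i = 0 ∧ ext e (i + 1) = 0))

/-- Entries at positions `0,...,n` of `f` contain no two consecutive zeros. -/
def NoZeroPair (n : ℕ) (f : ℕ → ℕ) : Prop :=
  ∀ i < n, ¬(f i = 0 ∧ f (i + 1) = 0)

theorem ext_snoc_of_lt {n : ℕ} (e : Fin n → ℕ) (a : ℕ) {i : ℕ} (hi : i < n) :
    ext (Fin.snoc e a : Fin (n + 1) → ℕ) i = ext e i := by
  simp [ext, Fin.snoc, hi, Nat.lt_succ_of_lt hi]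

theorem ext_snoc_self {n : ℕ} (e : Fin n → ℕ) (a : ℕ) :
    ext (Fin.snoc e a : Fin (n + 1) → ℕ) n = a := by
  simp [ext, Fin.snoc]

theorem noZeroPair_snoc {n : ℕ} (e : Fin (n + 1) → ℕ) (a : ℕ) :
    NoZeroPair (n + 1) (ext (Fin.snoc e a : Fin (n + 2) → ℕ)) ↔
      NoZeroPair n (ext e) ∧ ¬(ext e n = 0 ∧ a = 0) := by
  unfold NoZeroPair
  rw [Nat.forall_lt_succ_right, ext_snoc_self, ext_snoc_of_lt e a (Nat.lt_succ_self n)]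
  refine and_congr_left' (forall₂_congr fun i hi => ?_)
  rw [ext_snoc_of_lt e a (by omega), ext_snoc_of_lt e a (by omega)]

theorem ascN_snoc {n : ℕ} (e : Fin (n + 1) → ℕ) (a : ℕ) :
    ascN (n + 2) (ext (Fin.snoc e a : Fin (n + 2) → ℕ)) =
      ascN (n + 1) (ext e) + if ext e n < a then 1 else 0 := by
  unfold ascN
  simp only [Finset.card_filter, Nat.add_succ_sub_one]
  rw [Finset.sum_range_succ, ext_snoc_self, ext_snoc_of_lt e a (Nat.lt_succ_self n)]
  congr 1
  refine Finset.sum_congr rfl fun i hi => ?_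
  rw [Finset.mem_range] at hi
  rw [ext_snoc_of_lt e a (by omega), ext_snoc_of_lt e a (by omega)]

theorem sum_invSeqs_succ {M : Type*} [AddCommMonoid M] (n : ℕ) (F : (Fin (n + 1) → ℕ) → M) :
    ∑ e ∈ invSeqs (n + 1), F e =
      ∑ e ∈ invSeqs n, ∑ a ∈ Finset.range (n + 1), F (Fin.snoc e a) := by
  rw [← Finset.sum_product']
  symm
  refine Finset.sum_bij' (fun x _ => (Fin.snoc x.1 x.2 : Fin (n + 1) → ℕ))
    (fun e _ => (fun i => e i.castSucc, e (Fin.last n))) ?_ ?_ ?_ ?_ ?_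
  · rintro ⟨e, a⟩ h
    simp only [invSeqs, Finset.mem_product, Fintype.mem_piFinset] at h ⊢
    intro i
    refine Fin.lastCases ?_ (fun j => ?_) i
    · simpa using h.2
    · simpa using h.1 j
  · intro e h
    simp only [invSeqs, Finset.mem_product, Fintype.mem_piFinset] at h ⊢
    exact ⟨fun j => h j.castSucc, h (Fin.last n)⟩
  · simp
  · intro e _
    ext i
    refine Fin.lastCases ?_ (fun j => ?_) i <;> simp
  · simp

/-- One step of the transfer recurrence for a weight depending on the last value and on the
number of ascents. -/
def transferWeight {M : Type*} [AddCommMonoid M] (n : ℕ) (f : ℕ → ℕ → M) (v x : ℕ) : M :=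
  (∑ p ∈ Finset.range (n + 1), f (p + 1) (x + if v < p + 1 then 1 else 0)) +
    if v = 0 then 0 else f 0 x

open Classical in
/-- Total weight of the inversion sequences of length `n + 1` without consecutive zeros. -/
noncomputable def seqWeight {M : Type*} [AddCommMonoid M] (n : ℕ) (f : ℕ → ℕ → M) : M :=
  ∑ e ∈ invSeqs (n + 1),
    if NoZeroPair n (ext e) then f (ext e n) (ascN (n + 1) (ext e)) else 0

theorem seqWeight_succ {M : Type*} [AddCommMonoid M] (n : ℕ) (f : ℕ → ℕ → M) :
    seqWeight (n + 1) f = seqWeight n (transferWeight n f) := by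
  classical
  unfold seqWeight
  rw [sum_invSeqs_succ]
  refine Finset.sum_congr rfl fun e _ => ?_
  simp only [noZeroPair_snoc, ascN_snoc, ext_snoc_self]
  rw [Finset.sum_range_succ']
  by_cases h : NoZeroPair n (ext e)
  · simp [h, transferWeight]
  · simp [h]

theorem seqWeight_zero {M : Type*} [AddCommMonoid M] (f : ℕ → ℕ → M) :
    seqWeight 0 f = f 0 0 := by
  classical
  unfold seqWeight
  rw [sum_invSeqs_succ]
  have h : invSeqs 0 = {Fin.elim0} := by
    ext e
    simp [invSeqs, eq_iff_true_of_subsingleton]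
  simp [h, NoZeroPair, ascN, ext_snoc_self]

/-- Permutations in which only the last point may be fixed. -/
def AlmostDerangement {n : ℕ} (σ : Equiv.Perm (Fin (n + 1))) : Prop :=
  ∀ i, i ≠ Fin.last n → σ i ≠ i

/-- The one-based position of the largest value, or `0` if the last point is fixed. -/
def topPos {n : ℕ} (σ : Equiv.Perm (Fin (n + 1))) : ℕ :=
  if σ.symm (Fin.last n) = Fin.last n then 0 else (σ.symm (Fin.last n) : ℕ) + 1

/-- Number of excedances. -/
def excCount {n : ℕ} (σ : Equiv.Perm (Fin n)) : ℕ :=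
  (Finset.univ.filter (fun i => i < σ i)).card

/-- Extension of a permutation of `Fin n` to `Fin (n + 1)` along `p.succAbove`, fixing `p`. -/
def extendAt {n : ℕ} (p : Fin (n + 1)) (τ : Equiv.Perm (Fin n)) : Equiv.Perm (Fin (n + 1)) :=
  ((finSuccEquiv' p).trans (Equiv.optionCongr τ)).trans (finSuccEquiv' p).symm

/-- Insert `p` into the cycle structure of `τ` just before the largest element. -/
def insertBeforeLast {n : ℕ} (p : Fin (n + 1)) (τ : Equiv.Perm (Fin n)) :
    Equiv.Perm (Fin (n + 1)) :=
  Equiv.swap p (Fin.last n) * extendAt p τ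

theorem extendAt_self {n : ℕ} (p : Fin (n + 1)) (τ : Equiv.Perm (Fin n)) :
    extendAt p τ p = p := by
  simp [extendAt]

theorem extendAt_succAbove {n : ℕ} (p : Fin (n + 1)) (τ : Equiv.Perm (Fin n)) (i : Fin n) :
    extendAt p τ (p.succAbove i) = p.succAbove (τ i) := by
  simp [extendAt]

theorem insertBeforeLast_self {n : ℕ} (p : Fin (n + 1)) (τ : Equiv.Perm (Fin n)) :
    insertBeforeLast p τ p = Fin.last n := by
  simp [insertBeforeLast, extendAt_self]

theorem insertBeforeLast_symm_last {n : ℕ} (p : Fin (n + 1)) (τ : Equiv.Perm (Fin n)) :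
    (insertBeforeLast p τ).symm (Fin.last n) = p := by
  rw [Equiv.symm_apply_eq, insertBeforeLast_self]

theorem insertBeforeLast_last_castSucc {n : ℕ} (τ : Equiv.Perm (Fin n)) (i : Fin n) :
    insertBeforeLast (Fin.last n) τ i.castSucc = (τ i).castSucc := by
  have h := extendAt_succAbove (Fin.last n) τ i
  simp only [Fin.succAbove_last] at h
  simp [insertBeforeLast, h]

theorem insertBeforeLast_castSucc_succAbove {n : ℕ} (p : Fin (n + 1))
    (τ : Equiv.Perm (Fin (n + 1))) (i : Fin (n + 1)) :
    insertBeforeLast p.castSucc τ (p.castSucc.succAbove i) =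
      if τ i = Fin.last n then p.castSucc else p.castSucc.succAbove (τ i) := by
  have hlast : p.castSucc.succAbove (Fin.last n) = Fin.last (n + 1) :=
    Fin.succAbove_ne_last_last (Fin.castSucc_lt_last p).ne
  rw [insertBeforeLast, Equiv.Perm.mul_apply, extendAt_succAbove]
  split_ifs with h
  · rw [h, hlast, Equiv.swap_apply_right]
  · refine Equiv.swap_apply_of_ne_of_ne (Fin.succAbove_ne _ _) fun h' => h ?_
    exact Fin.succAbove_right_injective (h'.trans hlast.symm)

theorem insertBeforeLast_bijective (n : ℕ) :
    Function.Bijective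
      (fun x : Fin (n + 1) × Equiv.Perm (Fin n) => insertBeforeLast x.1 x.2) := by
  rw [Fintype.bijective_iff_injective_and_card]
  constructor
  · rintro ⟨p, τ⟩ ⟨q, ρ⟩ h
    dsimp only at h
    obtain rfl : p = q := by
      rw [← insertBeforeLast_symm_last p τ, h, insertBeforeLast_symm_last]
    have h' : extendAt p τ = extendAt p ρ := mul_left_cancel h
    have : τ = ρ := by
      ext1 i
      apply Fin.succAbove_right_injective (p := p)
      rw [← extendAt_succAbove, h', extendAt_succAbove]
    rw [this]
  · simp [Fintype.card_perm, Nat.factorial_succ]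

theorem sum_perm_fin_succ {M : Type*} [AddCommMonoid M] (n : ℕ)
    (F : Equiv.Perm (Fin (n + 1)) → M) :
    ∑ σ, F σ = ∑ τ : Equiv.Perm (Fin n), ∑ p : Fin (n + 1), F (insertBeforeLast p τ) := by
  rw [Finset.sum_comm, ← Fintype.sum_prod_type']
  exact ((insertBeforeLast_bijective n).sum_comp F).symm

theorem topPos_eq_zero_iff {n : ℕ} (σ : Equiv.Perm (Fin (n + 1))) :
    topPos σ = 0 ↔ σ (Fin.last n) = Fin.last n := by
  rw [eq_comm (a := σ _), ← Equiv.symm_apply_eq, topPos]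
  split_ifs with h <;> simp [h]

theorem topPos_insertBeforeLast_last {n : ℕ} (τ : Equiv.Perm (Fin n)) :
    topPos (insertBeforeLast (Fin.last n) τ) = 0 := by
  simp [topPos, insertBeforeLast_symm_last]

theorem topPos_insertBeforeLast_castSucc {n : ℕ} (p : Fin n) (τ : Equiv.Perm (Fin n)) :
    topPos (insertBeforeLast p.castSucc τ) = p + 1 := by
  simp [topPos, insertBeforeLast_symm_last, (Fin.castSucc_lt_last p).ne]

theorem almostDerangement_insertBeforeLast_last {n : ℕ} (τ : Equiv.Perm (Fin (n + 1))) :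
    AlmostDerangement (insertBeforeLast (Fin.last (n + 1)) τ) ↔
      AlmostDerangement τ ∧ topPos τ ≠ 0 := by
  rw [Ne, topPos_eq_zero_iff]
  unfold AlmostDerangement
  constructor
  · intro h
    have h' : ∀ i, τ i ≠ i := fun i hi => by
      refine h i.castSucc (Fin.castSucc_lt_last i).ne ?_
      rw [insertBeforeLast_last_castSucc, hi]
    exact ⟨fun i _ => h' i, h' _⟩
  · rintro ⟨h, h'⟩ i
    refine Fin.lastCases (fun hi => (hi rfl).elim) (fun j _ => ?_) i
    rw [insertBeforeLast_last_castSucc, Ne, Fin.castSucc_inj]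
    by_cases hj : j = Fin.last n
    · rwa [hj]
    · exact h j hj

theorem almostDerangement_insertBeforeLast_castSucc {n : ℕ} (p : Fin (n + 1))
    (τ : Equiv.Perm (Fin (n + 1))) :
    AlmostDerangement (insertBeforeLast p.castSucc τ) ↔ AlmostDerangement τ := by
  have hlast : p.castSucc.succAbove (Fin.last n) = Fin.last (n + 1) :=
    Fin.succAbove_ne_last_last (Fin.castSucc_lt_last p).ne
  unfold AlmostDerangement
  rw [Fin.forall_iff_succAbove p.castSucc, insertBeforeLast_self]
  simp only [insertBeforeLast_castSucc_succAbove, ← hlast, Ne, Fin.succAbove_right_inj]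
  constructor
  · rintro ⟨-, h⟩ i hi hτ
    apply h i hi
    simp [hτ, hi]
  · refine fun h => ⟨fun _ => Fin.succAbove_ne _ _, fun i hi => ?_⟩
    split_ifs with h'
    · exact (Fin.succAbove_ne _ _).symm
    · simpa using h i hi

theorem excCount_insertBeforeLast_last {n : ℕ} (τ : Equiv.Perm (Fin n)) :
    excCount (insertBeforeLast (Fin.last n) τ) = excCount τ := by
  simp only [excCount, Finset.card_filter]
  rw [Fin.sum_univ_castSucc]
  simp [insertBeforeLast_self, insertBeforeLast_last_castSucc]

theorem excCount_insertBeforeLast_castSucc {n : ℕ} (p : Fin (n + 1))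
    (τ : Equiv.Perm (Fin (n + 1))) :
    excCount (insertBeforeLast p.castSucc τ) =
      excCount τ + if topPos τ < p + 1 then 1 else 0 := by
  simp only [excCount, Finset.card_filter]
  rw [Fin.sum_univ_succAbove _ p.castSucc, insertBeforeLast_self,
    if_pos (Fin.castSucc_lt_last p)]
  simp only [insertBeforeLast_castSucc_succAbove]
  set m := τ.symm (Fin.last n) with hm
  have hτm : τ m = Fin.last n := by simp [hm]
  rw [← Finset.add_sum_erase _ _ (Finset.mem_univ m),
    ← Finset.add_sum_erase (a := m) _ (fun i => if i < τ i then 1 else 0) (Finset.mem_univ m)]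
  have hrest : ∀ i ∈ Finset.univ.erase m,
      (if p.castSucc.succAbove i <
          (if τ i = Fin.last n then p.castSucc else p.castSucc.succAbove (τ i)) then 1 else 0) =
        if i < τ i then 1 else 0 := by
    intro i hi
    have : τ i ≠ Fin.last n := fun h => (Finset.ne_of_mem_erase hi) (by simp [hm, ← h])
    simp [this]
  rw [Finset.sum_congr rfl hrest, hτm, if_pos rfl, topPos, ← hm]
  have hsucc : p.castSucc.succAbove m < p.castSucc ↔ m < p := by
    rw [Fin.succAbove_lt_iff_castSucc_lt, Fin.castSucc_lt_castSucc_iff]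
  simp only [hsucc]
  by_cases hml : m = Fin.last n
  · simp [hml, (Fin.le_last p).not_gt]
    omega
  · have : m < Fin.last n := Fin.lt_last_iff_ne_last.2 hml
    simp [hml, this]
    omega

open Classical in
/-- Total weight of the permutations of `Fin (n + 1)` in which only the last point may be fixed. -/
noncomputable def permWeight {M : Type*} [AddCommMonoid M] (n : ℕ) (f : ℕ → ℕ → M) : M :=
  ∑ σ : Equiv.Perm (Fin (n + 1)),
    if AlmostDerangement σ then f (topPos σ) (excCount σ) else 0

theorem permWeight_succ {M : Type*} [AddCommMonoid M] (n : ℕ) (f : ℕ → ℕ → M) :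
    permWeight (n + 1) f = permWeight n (transferWeight n f) := by
  classical
  unfold permWeight
  rw [sum_perm_fin_succ]
  refine Finset.sum_congr rfl fun τ _ => ?_
  rw [Fin.sum_univ_castSucc]
  simp only [almostDerangement_insertBeforeLast_last, almostDerangement_insertBeforeLast_castSucc,
    topPos_insertBeforeLast_last, topPos_insertBeforeLast_castSucc,
    excCount_insertBeforeLast_last, excCount_insertBeforeLast_castSucc]
  by_cases h : AlmostDerangement τ
  · simp only [h, if_true, true_and, transferWeight, Finset.sum_range, ne_eq, ite_not]
  · simp [h]

theorem permWeight_zero {M : Type*} [AddCommMonoid M] (f : ℕ → ℕ → M) :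
    permWeight 0 f = f 0 0 := by
  have h : AlmostDerangement (1 : Equiv.Perm (Fin 1)) :=
    fun i hi => (hi (Subsingleton.elim (α := Fin 1) _ _)).elim
  have htop : topPos (1 : Equiv.Perm (Fin 1)) = 0 := (topPos_eq_zero_iff _).2 rfl
  simp [permWeight, h, htop, excCount]

theorem seqWeight_eq_permWeight {M : Type*} [AddCommMonoid M] (n : ℕ) (f : ℕ → ℕ → M) :
    seqWeight n f = permWeight n f := by
  induction n generalizing f with
  | zero => rw [seqWeight_zero, permWeight_zero]
  | succ n ih => rw [seqWeight_succ, permWeight_succ, ih]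

theorem sum_derangeSeqs {M : Type*} [AddCommMonoid M] (n : ℕ) (g : ℕ → M) :
    ∑ e ∈ derangeSeqs (n + 1), g (ascN (n + 1) (ext e)) =
      seqWeight n fun v x => if v = 0 then 0 else g x := by
  classical
  rw [derangeSeqs, Finset.sum_filter, seqWeight]
  refine Finset.sum_congr rfl fun e _ => ?_
  have h : (ext e (n + 1 - 1) ≠ 0 ∧ ∀ i < n + 1 - 1, ¬(ext e i = 0 ∧ ext e (i + 1) = 0)) ↔
      NoZeroPair n (ext e) ∧ ext e n ≠ 0 := and_comm
  rw [if_congr h rfl rfl, ite_and, ite_not]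

theorem sum_derangements {M : Type*} [AddCommMonoid M] (n : ℕ) (g : ℕ → M) :
    ∑ σ ∈ Finset.univ.filter (fun σ : Equiv.Perm (Fin (n + 1)) => ∀ i, σ i ≠ i),
        g (excCount σ) =
      permWeight n fun v x => if v = 0 then 0 else g x := by
  classical
  rw [Finset.sum_filter, permWeight]
  refine Finset.sum_congr rfl fun σ _ => ?_
  have h : (∀ i, σ i ≠ i) ↔ AlmostDerangement σ ∧ topPos σ ≠ 0 := by
    rw [Ne, topPos_eq_zero_iff]
    refine ⟨fun h => ⟨fun i _ => h i, h _⟩, fun h i => ?_⟩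
    by_cases hi : i = Fin.last n
    · rw [hi]; exact h.2
    · exact h.1 i hi
  rw [if_congr h rfl rfl, ite_and, ite_not]

theorem sum_derangeSeqs_eq_sum_derangements {M : Type*} [AddCommMonoid M] {n : ℕ} (hn : 1 ≤ n)
    (g : ℕ → M) :
    ∑ e ∈ derangeSeqs n, g (ascN n (ext e)) =
      ∑ σ ∈ Finset.univ.filter (fun σ : Equiv.Perm (Fin n) => ∀ i, σ i ≠ i),
        g (excCount σ) := by
  obtain ⟨k, rfl⟩ := Nat.exists_eq_add_of_le' hn
  rw [sum_derangeSeqs, sum_derangements, seqWeight_eq_permWeight]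

/-- For `n ≥ 2`, `D_n` is equinumerous with the derangements of `{1,...,n}`, and the
ascent generating polynomial of `D_n` equals the excedance generating polynomial of
derangements. -/
theorem stmt3 (n : ℕ) (hn : 2 ≤ n) :
    (derangeSeqs n).card
        = (Finset.univ.filter (fun σ : Equiv.Perm (Fin n) => ∀ i, σ i ≠ i)).card ∧
    ∑ e ∈ derangeSeqs n, (Polynomial.X : Polynomial ℚ) ^ ascN n (ext e)
      = ∑ σ ∈ Finset.univ.filter (fun σ : Equiv.Perm (Fin n) => ∀ i, σ i ≠ i),
          (Polynomial.X : Polynomial ℚ) ^ (Finset.univ.filter (fun i => i < σ i)).card := by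
  have hn' : 1 ≤ n := by omega
  refine ⟨?_, sum_derangeSeqs_eq_sum_derangements hn' fun k => Polynomial.X ^ k⟩
  simpa only [Finset.card_eq_sum_ones] using
    sum_derangeSeqs_eq_sum_derangements hn' fun _ => 1
end

section
/- For every finite linearly ordered set E of cardinality n, the map Ψ sending a bijection σ : {1,...,n} → E to the set { S(σ,i) : i a descent of σ }, where S(σ,i) = { σ(j) : j ≥ i, σ(j) ≤ σ(i) }, is a bijection from the bijections {1,...,n} → E onto the set of 'normal' collections V of subsets of E; here V is normal if each S ∈ V has |S| ≥ 2 and for any distinct S_1, S_2 ∈ V (after possibly swapping), S_1 is the minimal initial segment of S := S_1 ∪ S_2 with S_1 ∪ S_2 = S, |S_2| ≥ 2, and |S \ S_2| ≥ 2 unless S_2 = S \ {max S}. -/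
/-- `I` is a (nonempty) initial segment of `J`: `I ⊆ J` and every element of `J`
that is `≤ max I` lies in `I` (the maximum encoded as an upper bound in `I`). -/
def InitSeg {E : Type*} [LinearOrder E] (I J : Finset E) : Prop :=
  I ⊆ J ∧ I.Nonempty ∧ ∀ m ∈ I, (∀ y ∈ I, y ≤ m) → ∀ x ∈ J, x ≤ m → x ∈ I

/-- The normality condition for an ordered pair `(S₁, S₂)`, with `S = S₁ ∪ S₂`:
`S₁` is an initial segment of `S`, minimal among initial segments `I` of `S` with
`I ∪ S₂ = S`, and `|S \ S₂| ≥ 2` unless `S₂ = S \ {max S}`. -/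
def NormalPair {E : Type*} [LinearOrder E] (S₁ S₂ : Finset E) : Prop :=
  InitSeg S₁ (S₁ ∪ S₂) ∧
  (∀ I : Finset E, InitSeg I (S₁ ∪ S₂) → I ∪ S₂ = S₁ ∪ S₂ → S₁ ⊆ I) ∧
  (2 ≤ ((S₁ ∪ S₂) \ S₂).card ∨
    ∀ m ∈ S₁ ∪ S₂, (∀ y ∈ S₁ ∪ S₂, y ≤ m) → S₂ = (S₁ ∪ S₂).erase m)

/-- A collection `V` of subsets of `E` is normal if every member has cardinality at
least 2 and any two distinct members form a normal pair in one of the two orders. -/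
def NormalColl {E : Type*} [LinearOrder E] (V : Finset (Finset E)) : Prop :=
  (∀ S ∈ V, 2 ≤ S.card) ∧
  ∀ S₁ ∈ V, ∀ S₂ ∈ V, S₁ ≠ S₂ → NormalPair S₁ S₂ ∨ NormalPair S₂ S₁

/-- `S(σ, i) = { σ l : l ≥ i, σ l ≤ σ i }` as a Finset. -/
def sSet {E : Type*} [LinearOrder E] {n : ℕ} (σ : Fin n → E) (i : Fin n) : Finset E :=
  Finset.image σ (Finset.univ.filter (fun l => i ≤ l ∧ σ l ≤ σ i))

/-- The Finset of descents of `σ : Fin n → E` (positions `i` with `i + 1 < n` and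
`σ (i+1) < σ i`). -/
def desSet {E : Type*} [LinearOrder E] {n : ℕ} (σ : Fin n → E) : Finset (Fin n) :=
  Finset.univ.filter (fun i => ∃ h : (i : ℕ) + 1 < n, σ ⟨(i : ℕ) + 1, h⟩ < σ i)

section DescentSets

variable {E : Type*} [LinearOrder E]

/-- The elements of `a :: l` that are at most `a`. -/
def headSet (a : E) (l : List E) : Finset E :=
  (a :: l).toFinset.filter (· ≤ a)

/-- The collection of the sets `S(σ, i)` over the descents `i` of a word `σ`. -/
def descentSets : List E → Finset (Finset E)
  | [] => ∅
  | [_] => ∅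
  | a :: b :: t =>
    if b < a then insert (headSet a (b :: t)) (descentSets (b :: t)) else descentSets (b :: t)

theorem mem_headSet {a x : E} {l : List E} : x ∈ headSet a l ↔ x = a ∨ x ∈ l ∧ x ≤ a := by
  simp only [headSet, Finset.mem_filter, List.mem_toFinset, List.mem_cons]
  constructor
  · tauto
  · rintro (rfl | h)
    · simp
    · tauto

theorem mem_descentSets_cons {a b : E} {t : List E} {S : Finset E} :
    S ∈ descentSets (a :: b :: t) ↔
      (b < a ∧ S = headSet a (b :: t)) ∨ S ∈ descentSets (b :: t) := by
  rw [descentSets]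
  split_ifs with h <;> simp [h]

theorem mem_of_mem_descentSets {l : List E} {S : Finset E} (hS : S ∈ descentSets l) {x : E}
    (hx : x ∈ S) : x ∈ l := by
  induction l using descentSets.induct with
  | case1 => simp [descentSets] at hS
  | case2 => simp [descentSets] at hS
  | case3 a b t h ih =>
    rcases mem_descentSets_cons.1 hS with ⟨-, rfl⟩ | hS
    · rcases mem_headSet.1 hx with rfl | hx
      · simp
      · exact List.mem_cons_of_mem _ hx.1
    · exact List.mem_cons_of_mem _ (ih hS)
  | case4 a b t h ih =>
    rw [descentSets, if_neg h] at hS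
    exact List.mem_cons_of_mem _ (ih hS)

/-- In a word without repetitions, the only descent set that can contain the first letter is the
one attached to the first position. -/
theorem eq_headSet_of_mem {a : E} {l : List E} (hl : (a :: l).Nodup) {S : Finset E}
    (hS : S ∈ descentSets (a :: l)) (ha : a ∈ S) : S = headSet a l := by
  cases l with
  | nil => simp [descentSets] at hS
  | cons b t =>
    rcases mem_descentSets_cons.1 hS with ⟨-, rfl⟩ | hS
    · rfl
    · exact absurd (mem_of_mem_descentSets hS ha) (List.nodup_cons.1 hl).1

/-- If some letter is smaller than the first one, then the set attached to the first descent
contains all such letters, and a letter at least as large as the first one. -/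
theorem exists_descentSet_of_lt {a x : E} {l : List E} (hx : x ∈ l) (hxa : x < a) :
    ∃ S ∈ descentSets (a :: l), (∀ y ∈ l, y < a → y ∈ S) ∧ ∃ c ∈ S, a ≤ c := by
  induction l generalizing a with
  | nil => simp at hx
  | cons b t ih =>
    by_cases hba : b < a
    · exact ⟨_, mem_descentSets_cons.2 (Or.inl ⟨hba, rfl⟩),
        fun y hy hya => mem_headSet.2 (Or.inr ⟨hy, hya.le⟩), a, mem_headSet.2 (Or.inl rfl), le_rfl⟩
    · have hab : a ≤ b := not_lt.1 hba
      have hmem : ∀ y ∈ b :: t, y < a → y ∈ t := by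
        intro y hy hya
        rcases List.mem_cons.1 hy with rfl | hy
        · contradiction
        · exact hy
      obtain ⟨S, hS, hlt, c, hc, hbc⟩ := ih (hmem x hx hxa) (hxa.trans_le hab)
      exact ⟨S, mem_descentSets_cons.2 (Or.inr hS),
        fun y hy hya => hlt y (hmem y hy hya) (hya.trans_le hab), c, hc, hab.trans hbc⟩

theorem descentSets_cons_eq_or {a : E} {l : List E} (hl : (a :: l).Nodup) :
    (headSet a l ∈ descentSets (a :: l) ∧
        descentSets l = (descentSets (a :: l)).erase (headSet a l)) ∨
      ((∀ S ∈ descentSets (a :: l), a ∉ S) ∧ descentSets l = descentSets (a :: l)) := by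
  have hnot : ∀ S ∈ descentSets l, a ∉ S := fun S hS ha =>
    (List.nodup_cons.1 hl).1 (mem_of_mem_descentSets hS ha)
  cases l with
  | nil => simp [descentSets]
  | cons b t =>
    by_cases hba : b < a
    · left
      have : headSet a (b :: t) ∉ descentSets (b :: t) := fun h =>
        hnot _ h (mem_headSet.2 (Or.inl rfl))
      simp [descentSets, hba, this]
    · right
      have : descentSets (b :: t) = descentSets (a :: b :: t) := by simp [descentSets, hba]
      exact ⟨this ▸ hnot, this⟩

/-- A letter smaller than the first one cannot be the first letter of another word with the same
letters and the same descent sets. -/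
theorem not_lt_head_of_descentSets_eq {a b : E} {s t : List E} (hs : (a :: s).Nodup)
    (ht : (b :: t).Nodup) (hset : ∀ x, x ∈ a :: s ↔ x ∈ b :: t)
    (h : descentSets (a :: s) = descentSets (b :: t)) : ¬ a < b := by
  intro hab
  have hat : a ∈ t := by
    rcases List.mem_cons.1 ((hset a).1 (by simp)) with rfl | h
    · exact absurd hab (lt_irrefl _)
    · exact h
  obtain ⟨S, hS, hlt, c, hc, hbc⟩ := exists_descentSet_of_lt hat hab
  obtain rfl := eq_headSet_of_mem hs (h ▸ hS) (hlt a hat hab)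
  rcases mem_headSet.1 hc with rfl | hc
  · exact absurd hab (not_lt.2 hbc)
  · exact absurd (hab.trans_le hbc) (not_lt.2 hc.2)

theorem eq_of_descentSets_eq {s t : List E} (hs : s.Nodup) (ht : t.Nodup)
    (hset : ∀ x, x ∈ s ↔ x ∈ t) (h : descentSets s = descentSets t) : s = t := by
  induction s generalizing t with
  | nil =>
    refine (List.eq_nil_iff_forall_not_mem.2 fun x hx => ?_).symm
    simpa using (hset x).2 hx
  | cons a s ih =>
    cases t with
    | nil => simpa using (hset a).1 (by simp)
    | cons b t =>
      obtain rfl : a = b := le_antisymm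
        (not_lt.1 (not_lt_head_of_descentSets_eq ht hs (fun x => (hset x).symm) h.symm))
        (not_lt.1 (not_lt_head_of_descentSets_eq hs ht hset h))
      have has := (List.nodup_cons.1 hs).1
      have hat := (List.nodup_cons.1 ht).1
      have hset' : ∀ x, x ∈ s ↔ x ∈ t := by
        intro x
        have := hset x
        simp only [List.mem_cons] at this
        by_cases hx : x = a
        · subst hx; tauto
        · tauto
      have hhead : headSet a s = headSet a t := by
        ext x; simp [mem_headSet, hset']
      have ha : a ∈ headSet a t := mem_headSet.2 (Or.inl rfl)
      congr 1
      refine ih (List.nodup_cons.1 hs).2 (List.nodup_cons.1 ht).2 hset' ?_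
      rcases descentSets_cons_eq_or hs with ⟨h1, h2⟩ | ⟨h1, h2⟩ <;>
        rcases descentSets_cons_eq_or ht with ⟨h3, h4⟩ | ⟨h3, h4⟩
      · rw [h2, h4, hhead, h]
      · exact absurd ha (h3 _ (h ▸ hhead ▸ h1))
      · exact absurd ha (h1 _ (h ▸ h3))
      · rw [h2, h4, h]

/-- A description of normal pairs through the maximum `m` of the first set. -/
theorem normalPair_iff {S T : Finset E} (hS : 2 ≤ S.card) :
    NormalPair S T ↔ ∃ m ∈ S, (∀ y ∈ S, y ≤ m) ∧ m ∉ T ∧ (∀ x ∈ T, x ≤ m → x ∈ S) ∧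
      ((∃ y ∈ S, y ≠ m ∧ y ∉ T) ∨ T = S.erase m) := by
  constructor
  · rintro ⟨⟨-, hne, hinit⟩, hmin, hcard⟩
    have hm := S.max'_mem hne
    have hle : ∀ y ∈ S, y ≤ S.max' hne := fun y hy => S.le_max' y hy
    generalize S.max' hne = m at hm hle
    have hTS : ∀ x ∈ T, x ≤ m → x ∈ S := fun x hx hxm =>
      hinit m hm hle x (Finset.mem_union_right _ hx) hxm
    have hmT : m ∉ T := by
      intro hmT
      have hne' : (S.erase m).Nonempty := by
        rw [← Finset.card_pos, Finset.card_erase_of_mem hm]; omega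
      have hsub := hmin (S.erase m)
        ⟨fun x hx => Finset.mem_union_left _ (Finset.mem_of_mem_erase hx),
          hne', fun k hk _ x hx hxk => ?_⟩ ?_ hm
      · simp at hsub
      · have hk' := Finset.mem_erase.1 hk
        have hkm : k < m := lt_of_le_of_ne (hle k hk'.2) hk'.1
        have hxm : x < m := hxk.trans_lt hkm
        exact Finset.mem_erase.2 ⟨hxm.ne, hinit m hm hle x hx hxm.le⟩
      · ext x
        by_cases hx : x = m
        · subst hx; simp [hmT]
        · simp [hx]
    refine ⟨m, hm, hle, hmT, hTS, ?_⟩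
    rcases hcard with hcard | herase
    · left
      obtain ⟨y, hy, hym⟩ := Finset.exists_mem_ne hcard m
      simp only [Finset.mem_sdiff, Finset.mem_union] at hy
      exact ⟨y, by tauto, hym, hy.2⟩
    · right
      have hne'' : (S ∪ T).Nonempty := ⟨m, Finset.mem_union_left _ hm⟩
      have heq := herase _ ((S ∪ T).max'_mem hne'') fun y hy => (S ∪ T).le_max' y hy
      have hmax : m = (S ∪ T).max' hne'' := by
        by_contra hcon
        exact hmT (heq ▸ Finset.mem_erase.2 ⟨hcon, Finset.mem_union_left _ hm⟩)
      have hTm : ∀ x ∈ T, x ∈ S := fun x hx =>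
        hTS x hx (hmax ▸ (S ∪ T).le_max' x (Finset.mem_union_right _ hx))
      rw [← hmax, Finset.union_eq_left.2 hTm] at heq
      exact heq
  · rintro ⟨m, hm, hle, hmT, hTS, hor⟩
    refine ⟨⟨Finset.subset_union_left, ⟨m, hm⟩, fun k hk hmax x hx hxk => ?_⟩,
      fun I hI hIT => ?_, ?_⟩
    · rcases Finset.mem_union.1 hx with hx | hx
      · exact hx
      · exact hTS x hx (hxk.trans (hle k hk))
    · have hmI : m ∈ I := by
        have : m ∈ I ∪ T := hIT ▸ Finset.mem_union_left _ hm
        exact (Finset.mem_union.1 this).resolve_right hmT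
      intro x hx
      exact hI.2.2 _ (I.max'_mem ⟨m, hmI⟩) (fun y hy => I.le_max' y hy) x
        (Finset.mem_union_left _ hx) ((hle x hx).trans (I.le_max' m hmI))
    · rcases hor with ⟨y, hy, hym, hyT⟩ | rfl
      · left
        exact Finset.one_lt_card.2 ⟨y, by simp [hy, hyT], m, by simp [hm, hmT], hym⟩
      · right
        intro k hk hmax
        rw [Finset.union_eq_left.2 (Finset.erase_subset _ _)] at hk hmax ⊢
        rw [le_antisymm (hmax m hm) (hle k hk)]

theorem normalColl_descentSets {l : List E} (hl : l.Nodup) : NormalColl (descentSets l) := by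
  induction l using descentSets.induct with
  | case1 => simp [descentSets, NormalColl]
  | case2 => simp [descentSets, NormalColl]
  | case4 a b t h ih =>
    rw [descentSets, if_neg h]
    exact ih (List.nodup_cons.1 hl).2
  | case3 a b t h ih =>
    rw [descentSets, if_pos h]
    obtain ⟨hal, hl'⟩ := List.nodup_cons.1 hl
    obtain ⟨hcard, hpair⟩ := ih hl'
    have ha : a ∈ headSet a (b :: t) := mem_headSet.2 (Or.inl rfl)
    have hb : b ∈ headSet a (b :: t) := mem_headSet.2 (Or.inr ⟨by simp, h.le⟩)
    have hcardHead : 2 ≤ (headSet a (b :: t)).card := Finset.one_lt_card.2 ⟨b, hb, a, ha, h.ne⟩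
    have hhead : ∀ T ∈ descentSets (b :: t), NormalPair (headSet a (b :: t)) T := by
      intro T hT
      have haT : a ∉ T := fun haT => hal (mem_of_mem_descentSets hT haT)
      refine (normalPair_iff hcardHead).2 ⟨a, ha, fun y hy => ?_, haT,
        fun x hx hxa => mem_headSet.2 (Or.inr ⟨mem_of_mem_descentSets hT hx, hxa⟩), ?_⟩
      · rcases mem_headSet.1 hy with rfl | hy
        exacts [le_rfl, hy.2]
      · by_contra! hcon
        obtain ⟨hsub, hne⟩ := hcon
        have hTb := eq_headSet_of_mem hl' hT (hsub b hb h.ne)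
        refine hne (Finset.Subset.antisymm (fun x hx => ?_) fun x hx => ?_)
        · refine Finset.mem_erase.2 ⟨fun hxa => haT (hxa ▸ hx),
            mem_headSet.2 (Or.inr ⟨mem_of_mem_descentSets hT hx, ?_⟩)⟩
          rw [hTb] at hx
          rcases mem_headSet.1 hx with rfl | hx
          exacts [h.le, hx.2.trans h.le]
        · exact hsub x (Finset.mem_of_mem_erase hx) (Finset.ne_of_mem_erase hx)
    refine ⟨fun S hS => ?_, fun S hS T hT hST => ?_⟩
    · rcases Finset.mem_insert.1 hS with rfl | hS
      exacts [hcardHead, hcard S hS]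
    · rcases Finset.mem_insert.1 hS with rfl | hS <;> rcases Finset.mem_insert.1 hT with rfl | hT
      · contradiction
      · exact Or.inl (hhead T hT)
      · exact Or.inr (hhead S hS)
      · exact hpair S hS T hT hST

theorem NormalColl.mono {V W : Finset (Finset E)} (hV : NormalColl V) (h : W ⊆ V) :
    NormalColl W :=
  ⟨fun S hS => hV.1 S (h hS), fun S hS T hT => hV.2 S (h hS) T (h hT)⟩

/-- A nonempty normal collection has a member whose maximum lies in no other member, and which
contains every smaller element of every other member. -/
theorem NormalColl.exists_source {V : Finset (Finset E)} (hV : NormalColl V) (hne : V.Nonempty) :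
    ∃ S ∈ V, ∃ m ∈ S, (∀ y ∈ S, y ≤ m) ∧
      ∀ T ∈ V, T ≠ S → m ∉ T ∧ ∀ x ∈ T, x ≤ m → x ∈ S := by
  induction hne using Finset.Nonempty.cons_induction with
  | singleton S =>
    have hS : S.Nonempty := Finset.card_pos.1 (by have := hV.1 S (by simp); omega)
    exact ⟨S, by simp, S.max' hS, S.max'_mem hS, fun y hy => S.le_max' y hy,
      fun T hT hTS => absurd (Finset.mem_singleton.1 hT) hTS⟩
  | cons R W hR hW ih =>
    have hRV : R ∈ Finset.cons R W hR := by simp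
    have hWV : W ⊆ Finset.cons R W hR := Finset.subset_cons hR
    obtain ⟨S, hS, m, hm, hle, hsource⟩ := ih (hV.mono hWV)
    have hRS : R ≠ S := fun h => hR (h ▸ hS)
    rcases hV.2 R hRV S (hWV hS) hRS with hpair | hpair
    · obtain ⟨k, hk, hkle, hkS, hSR, -⟩ := (normalPair_iff (hV.1 R hRV)).1 hpair
      refine ⟨R, hRV, k, hk, hkle, fun T hT hTR => ?_⟩
      have hTW : T ∈ W := (Finset.mem_cons.1 hT).resolve_left hTR
      by_cases hTS : T = S
      · subst hTS; exact ⟨hkS, hSR⟩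
      obtain ⟨hmT, hTS⟩ := hsource T hTW hTS
      rcases hV.2 R hRV T hT (Ne.symm hTR) with hpair | hpair
      · obtain ⟨k', hk', hkle', hkT, hTR, -⟩ := (normalPair_iff (hV.1 R hRV)).1 hpair
        obtain rfl := le_antisymm (hkle k' hk') (hkle' k hk)
        exact ⟨hkT, hTR⟩
      · exfalso
        obtain ⟨p, hp, hple, hpR, hRT, -⟩ := (normalPair_iff (hV.1 T hT)).1 hpair
        rcases le_total k m with hkm | hkm
        · rcases le_total k p with hkp | hkp
          · exact hkS (hTS k (hRT k hk hkp) hkm)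
          · exact hpR (hSR p (hTS p hp (hkp.trans hkm)) hkp)
        · rcases le_total m p with hmp | hmp
          · exact hmT (hRT m (hSR m hm hkm) hmp)
          · exact hpR (hSR p (hTS p hp hmp) (hmp.trans hkm))
    · obtain ⟨k, hk, hkle, hkR, hRS', -⟩ := (normalPair_iff (hV.1 S (hWV hS))).1 hpair
      obtain rfl := le_antisymm (hle k hk) (hkle m hm)
      refine ⟨S, hWV hS, k, hk, hkle, fun T hT hTS => ?_⟩
      rcases Finset.mem_cons.1 hT with rfl | hT
      exacts [⟨hkR, hRS'⟩, hsource T hT hTS]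

theorem exists_descentSets_eq (A : Finset E) (V : Finset (Finset E)) (hV : NormalColl V)
    (hVA : ∀ S ∈ V, S ⊆ A) : ∃ l : List E, l.Nodup ∧ l.toFinset = A ∧ descentSets l = V := by
  induction A using Finset.strongInduction generalizing V with
  | H A ih =>
  by_cases hP : ∃ a ∈ A, A.filter (· ≤ a) ∈ V ∧ ∀ T ∈ V, a ∈ T → T = A.filter (· ≤ a)
  · obtain ⟨a, haA, haV, haT⟩ := hP
    obtain ⟨t, htn, htA, htV⟩ := ih (A.erase a) (Finset.erase_ssubset haA)
      (V.erase (A.filter (· ≤ a))) (hV.mono (Finset.erase_subset _ _)) (fun S hS x hx => by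
        obtain ⟨hne, hS⟩ := Finset.mem_erase.1 hS
        exact Finset.mem_erase.2 ⟨fun hxa => hne (haT S hS (hxa ▸ hx)), hVA S hS hx⟩)
    have hmem : ∀ x, x ∈ t ↔ x ≠ a ∧ x ∈ A := fun x => by
      rw [← List.mem_toFinset, htA, Finset.mem_erase]
    have hat : a ∉ t := fun h => ((hmem a).1 h).1 rfl
    have hhead : headSet a t = A.filter (· ≤ a) := by
      ext x
      rw [mem_headSet, hmem, Finset.mem_filter]
      by_cases hx : x = a
      · subst hx; simp [haA]
      · simp [hx]
    refine ⟨a :: t, List.nodup_cons.2 ⟨hat, htn⟩, ?_, ?_⟩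
    · rw [List.toFinset_cons, htA, Finset.insert_erase haA]
    obtain ⟨x, hx, hxa⟩ := Finset.exists_mem_ne (hV.1 _ haV) a
    obtain ⟨hxA, hxle⟩ := Finset.mem_filter.1 hx
    have hxt : x ∈ t := (hmem x).2 ⟨hxa, hxA⟩
    cases t with
    | nil => simp at hxt
    | cons b t =>
      have hba : b < a := by
        by_contra hab
        have hab : a < b := lt_of_le_of_ne (not_lt.1 hab) fun h => hat (by simp [h])
        have hlt_mem : ∀ y ∈ b :: t, y < b → y ∈ t := by
          intro y hy hyb
          exact (List.mem_cons.1 hy).resolve_left hyb.ne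
        obtain ⟨S, hS, hlt, c, hc, hbc⟩ :=
          exists_descentSet_of_lt (hlt_mem x hxt (hxle.trans_lt hab)) (hxle.trans_lt hab)
        have hac := hab.trans_le hbc
        rw [htV] at hS
        obtain ⟨hne, hSV⟩ := Finset.mem_erase.1 hS
        have haS : a ∉ S := fun h => hne (haT S hSV h)
        have haF : a ∈ A.filter (· ≤ a) := Finset.mem_filter.2 ⟨haA, le_rfl⟩
        rcases hV.2 _ haV S hSV hne.symm with hpair | hpair
        · obtain ⟨m, hm, hle, -, -, hor⟩ := (normalPair_iff (hV.1 _ haV)).1 hpair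
          obtain rfl : m = a := le_antisymm (Finset.mem_filter.1 hm).2 (hle a haF)
          rcases hor with ⟨y, hy, hym, hyS⟩ | rfl
          · obtain ⟨hyA, hyle⟩ := Finset.mem_filter.1 hy
            have hyb := hyle.trans_lt hab
            exact hyS (hlt y (hlt_mem y ((hmem y).2 ⟨hym, hyA⟩) hyb) hyb)
          · exact absurd (Finset.mem_filter.1 (Finset.mem_of_mem_erase hc)).2 (not_le.2 hac)
        · obtain ⟨m, -, hle, -, hsub, -⟩ := (normalPair_iff (hV.1 _ hSV)).1 hpair
          exact haS (hsub a haF (hac.le.trans (hle c hc)))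
      rw [descentSets, if_pos hba, hhead, htV, Finset.insert_erase haV]
  · by_cases hA : (A \ V.sup id).Nonempty
    · have haA := Finset.min'_mem _ hA
      have hmin : ∀ b ∈ A \ V.sup id, (A \ V.sup id).min' hA ≤ b := fun b hb =>
        Finset.min'_le _ b hb
      generalize (A \ V.sup id).min' hA = a at haA hmin
      simp only [Finset.mem_sdiff, Finset.mem_sup, id, not_exists, not_and] at haA hmin
      obtain ⟨haA, haV⟩ := haA
      obtain ⟨t, htn, htA, htV⟩ := ih (A.erase a) (Finset.erase_ssubset haA) V hV
        (fun S hS x hx => Finset.mem_erase.2 ⟨fun hxa => haV S hS (hxa ▸ hx), hVA S hS hx⟩)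
      have hmem : ∀ x, x ∈ t ↔ x ≠ a ∧ x ∈ A := fun x => by
        rw [← List.mem_toFinset, htA, Finset.mem_erase]
      have hat : a ∉ t := fun h => ((hmem a).1 h).1 rfl
      refine ⟨a :: t, List.nodup_cons.2 ⟨hat, htn⟩, ?_, ?_⟩
      · rw [List.toFinset_cons, htA, Finset.insert_erase haA]
      cases t with
      | nil => exact htV
      | cons b t =>
        have hba : ¬ b < a := by
          intro hba
          have hbA : b ∈ A := ((hmem b).1 (by simp)).2
          have hhead : headSet b t = A.filter (· ≤ b) := by
            ext x
            rw [mem_headSet, Finset.mem_filter]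
            have := hmem x
            rw [List.mem_cons] at this
            constructor
            · rintro (rfl | ⟨hx, hxb⟩)
              · exact ⟨hbA, le_rfl⟩
              · exact ⟨(this.1 (Or.inr hx)).2, hxb⟩
            · rintro ⟨hx, hxb⟩
              have := this.2 ⟨(hxb.trans_lt hba).ne, hx⟩
              tauto
          have hbT : ∀ T ∈ V, b ∈ T → T = A.filter (· ≤ b) := fun T hT hb =>
            hhead ▸ eq_headSet_of_mem htn (htV ▸ hT) hb
          have : ∃ T ∈ V, b ∈ T := by
            by_contra! hcon
            exact absurd (hmin b ⟨hbA, hcon⟩) (not_le.2 hba)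
          obtain ⟨T, hT, hb⟩ := this
          exact hP ⟨b, hbA, hbT T hT hb ▸ hT, hbT⟩
        rw [descentSets, if_neg hba, htV]
    · have hcover : ∀ x ∈ A, ∃ T ∈ V, x ∈ T := by
        intro x hx
        by_contra! hcon
        exact hA ⟨x, by simpa [Finset.mem_sup, hx] using hcon⟩
      rcases A.eq_empty_or_nonempty with rfl | ⟨x, hx⟩
      · refine ⟨[], by simp, by simp, ?_⟩
        refine (Finset.eq_empty_of_forall_notMem fun S hS => ?_).symm
        have := hV.1 S hS
        simp [Finset.subset_empty.1 (hVA S hS)] at this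
      · exfalso
        obtain ⟨R, hR, -⟩ := hcover x hx
        obtain ⟨S, hS, m, hm, hle, hsource⟩ := hV.exists_source ⟨R, hR⟩
        have hSA : S = A.filter (· ≤ m) := by
          ext y
          refine ⟨fun hy => Finset.mem_filter.2 ⟨hVA S hS hy, hle y hy⟩, fun hy => ?_⟩
          obtain ⟨hyA, hym⟩ := Finset.mem_filter.1 hy
          obtain ⟨T, hT, hyT⟩ := hcover y hyA
          by_cases hTS : T = S
          · exact hTS ▸ hyT
          · exact (hsource T hT hTS).2 y hyT hym
        refine hP ⟨m, hVA S hS hm, hSA ▸ hS, fun T hT hmT => ?_⟩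
        by_contra hTS
        exact (hsource T hT (hSA ▸ hTS)).1 hmT

theorem mem_sSet {n : ℕ} {σ : Fin n → E} {i : Fin n} {x : E} :
    x ∈ sSet σ i ↔ ∃ l, i ≤ l ∧ σ l ≤ σ i ∧ σ l = x := by
  simp [sSet, and_assoc]

theorem sSet_zero {n : ℕ} (σ : Fin (n + 1) → E) :
    sSet σ 0 = headSet (σ 0) (List.ofFn fun i => σ (Fin.succ i)) := by
  ext x
  rw [mem_sSet, mem_headSet, Fin.exists_fin_succ]
  simp only [List.mem_ofFn, Fin.zero_le, true_and, le_refl]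
  constructor
  · rintro (rfl | ⟨i, hi, rfl⟩)
    · exact Or.inl rfl
    · exact Or.inr ⟨⟨i, rfl⟩, hi⟩
  · rintro (rfl | ⟨⟨i, rfl⟩, hi⟩)
    · exact Or.inl rfl
    · exact Or.inr ⟨i, hi, rfl⟩

theorem sSet_succ {n : ℕ} (σ : Fin (n + 1) → E) (i : Fin n) :
    sSet σ i.succ = sSet (fun j => σ (Fin.succ j)) i := by
  ext x
  rw [mem_sSet, mem_sSet, Fin.exists_fin_succ]
  simp [Fin.succ_le_succ_iff]

theorem descentSets_ofFn {n : ℕ} (σ : Fin n → E) :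
    descentSets (List.ofFn σ) = Finset.image (sSet σ) (desSet σ) := by
  induction n with
  | zero => simp [descentSets, desSet]
  | succ n ih =>
    ext S
    have hsucc := ih fun i => σ (Fin.succ i)
    rw [Finset.mem_image, Fin.exists_fin_succ]
    simp only [sSet_succ]
    cases n with
    | zero =>
      have : (0 : Fin (0 + 1)) ∉ desSet σ := by
        simp only [desSet, Finset.mem_filter, not_and, not_exists]
        intro _ h
        exact absurd h (by simp)
      simp [descentSets, this]
    | succ n =>
      have hcons : List.ofFn (fun i => σ (Fin.succ i)) =
          σ 1 :: List.ofFn fun i => σ (Fin.succ (Fin.succ i)) := by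
        rw [List.ofFn_succ]; rfl
      rw [List.ofFn_succ, hcons, mem_descentSets_cons, ← hcons, ← sSet_zero, hsucc,
        Finset.mem_image]
      refine or_congr ?_ (exists_congr fun i => and_congr_left fun _ => ?_)
      · simp [desSet, eq_comm]
      · simp [desSet, Fin.succ]

end DescentSets

/-- The map `Ψ`, sending a bijection `σ : Fin n → E` to the collection
`{ S(σ,i) : i a descent of σ }`, is a bijection onto the normal collections. -/
theorem stmt10 {E : Type*} [Fintype E] [LinearOrder E] (n : ℕ)
    (hn : Fintype.card E = n) :
    Set.BijOn (fun σ : Fin n ≃ E => Finset.image (sSet ⇑σ) (desSet ⇑σ))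
      (Set.univ : Set (Fin n ≃ E)) {V : Finset (Finset E) | NormalColl V} := by
  refine ⟨fun σ _ => ?_, fun σ _ τ _ h => ?_, fun V hV => ?_⟩
  · change NormalColl (Finset.image (sSet σ) (desSet σ))
    rw [← descentSets_ofFn]
    exact normalColl_descentSets (List.nodup_ofFn.2 σ.injective)
  · simp only [← descentSets_ofFn] at h
    exact DFunLike.coe_injective (List.ofFn_injective (eq_of_descentSets_eq
      (List.nodup_ofFn.2 σ.injective) (List.nodup_ofFn.2 τ.injective)
      (fun x => by simp [List.mem_ofFn, σ.surjective x, τ.surjective x]) h))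
  · obtain ⟨l, hl, hset, hdes⟩ :=
      exists_descentSets_eq Finset.univ V hV fun S _ => Finset.subset_univ S
    have hlen : l.length = n := by
      rw [← List.toFinset_card_of_nodup hl, hset, Finset.card_univ, hn]
    subst hlen
    have hbij : Function.Bijective l.get := by
      refine ⟨List.nodup_iff_injective_get.1 hl, fun x => List.mem_iff_get.1 ?_⟩
      rw [← List.mem_toFinset, hset]
      exact Finset.mem_univ x
    refine ⟨Equiv.ofBijective l.get hbij, Set.mem_univ _, ?_⟩
    simp only [← descentSets_ofFn, Equiv.coe_ofBijective, List.ofFn_get]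
    exact hdes
end
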